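/- Let x₀ < x₁ < x₂ be real numbers, let E₁ := (x₀, x₁) and E₂ := (x₂, +∞), and let I₂ := (x₂, x₂ + 2). Then there exists a constant C > 0, depending only on x₀, x₁, x₂, such that for every measurable f : E₁ ∪ E₂ → ℝ, integrable on every bounded measurable subset of E₁ ∪ E₂, with |f|_{Ḣ^{1/2}(E₁)} < ∞ and |f|_{Ḣ^{1/2}(E₂)} < ∞, there exists a measurable f̃ : ℝ → ℝ, integrable on every bounded measurable subset of ℝ, such that f̃ = f almost everywhere on E₁ ∪ E₂ and |f̃|_{Ḣ^{1/2}(ℝ)} ≤ C ( |f|_{Ḣ^{1/2}(E₁)} + |f|_{Ḣ^{1/2}(E₂)} + | avg_{E₁} f − avg_{I₂} f | ). -/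

import Mathlib

open MeasureTheory Set Filter
open scoped ENNReal BigOperators

noncomputable def screenedSeminorm (I : Set ℝ) (r : ℝ) (f : ℝ → ℝ) : ℝ≥0∞ :=
  (∫⁻ x in I, ∫⁻ y in I ∩ Set.Ioo (x - r) (x + r),
      ENNReal.ofReal ((f y - f x) ^ 2 / (y - x) ^ 2)) ^ (1 / 2 : ℝ)

def LocIntOn (I : Set ℝ) (f : ℝ → ℝ) : Prop :=
  ∀ s : Set ℝ, s ⊆ I → MeasurableSet s → Bornology.IsBounded s →
    MeasureTheory.IntegrableOn f s

noncomputable def avgOn (J : Set ℝ) (f : ℝ → ℝ) : ℝ :=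
  (MeasureTheory.volume J).toReal⁻¹ * ∫ x in J, f x

/-- The squared increments of `f`, screened at distance `r`. -/
noncomputable def incrementSq (f : ℝ → ℝ) (r x y : ℝ) : ℝ≥0∞ :=
  if |y - x| < r then ENNReal.ofReal ((f y - f x) ^ 2) else 0

/-- The screened difference quotients whose double integral is the squared seminorm. -/
noncomputable def screenedKernel (f : ℝ → ℝ) (x y : ℝ) : ℝ≥0∞ :=
  if |y - x| < 1 then ENNReal.ofReal ((f y - f x) ^ 2 / (y - x) ^ 2) else 0

/-- The square of the seminorm with unit screening radius. -/
noncomputable def screenedEnergy (I : Set ℝ) (f : ℝ → ℝ) : ℝ≥0∞ :=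
  ∫⁻ x in I, ∫⁻ y in I, screenedKernel f x y

theorem measurableSet_abs_sub_lt (r : ℝ) : MeasurableSet {p : ℝ × ℝ | |p.2 - p.1| < r} :=
  measurableSet_lt (by fun_prop) (by fun_prop)

theorem measurable_incrementSq {f : ℝ → ℝ} (hf : Measurable f) (r : ℝ) :
    Measurable fun p : ℝ × ℝ => incrementSq f r p.1 p.2 :=
  Measurable.ite (measurableSet_abs_sub_lt r) (by fun_prop) measurable_const

theorem measurable_screenedKernel {f : ℝ → ℝ} (hf : Measurable f) :
    Measurable fun p : ℝ × ℝ => screenedKernel f p.1 p.2 :=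
  Measurable.ite (measurableSet_abs_sub_lt 1) (by fun_prop) measurable_const

theorem screenedSeminorm_one_eq (I : Set ℝ) (f : ℝ → ℝ) :
    screenedSeminorm I 1 f = screenedEnergy I f ^ (1 / 2 : ℝ) := by
  unfold screenedSeminorm screenedEnergy
  congr 2
  funext x
  rw [inter_comm, ← Measure.restrict_restrict measurableSet_Ioo,
    ← lintegral_indicator measurableSet_Ioo]
  congr 1
  funext y
  have : y ∈ Ioo (x - 1) (x + 1) ↔ |y - x| < 1 := by
    rw [abs_lt, mem_Ioo]
    constructor <;> rintro ⟨_, _⟩ <;> constructor <;> linarith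
  by_cases h : |y - x| < 1 <;> simp [indicator, this, screenedKernel, h]

theorem screenedEnergy_mono {I J : Set ℝ} (h : I ⊆ J) (f : ℝ → ℝ) :
    screenedEnergy I f ≤ screenedEnergy J f :=
  (lintegral_mono_set h).trans (lintegral_mono fun _ => lintegral_mono_set h)

theorem screenedEnergy_congr_ae {I : Set ℝ} {f g : ℝ → ℝ}
    (h : ∀ᵐ x ∂volume.restrict I, f x = g x) : screenedEnergy I f = screenedEnergy I g := by
  refine lintegral_congr_ae ?_
  filter_upwards [h] with x hx
  refine lintegral_congr_ae ?_
  filter_upwards [h] with y hy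
  rw [screenedKernel, screenedKernel, hx, hy]

theorem lintegral_comp_midpoint (x : ℝ) {G : ℝ → ℝ≥0∞} (hG : Measurable G) :
    ∫⁻ y, G ((x + y) / 2) = 2 * ∫⁻ z, G z := by
  have h := Real.map_volume_mul_left (a := (2 : ℝ)⁻¹) (by norm_num)
  have e : ∫⁻ y, G ((x + y) / 2) = ∫⁻ y, G (x / 2 + 2⁻¹ * y) := by
    congr 1; funext y; congr 1; ring
  rw [e, ← lintegral_map (μ := volume) (f := fun z => G (x / 2 + z)) (g := fun y => 2⁻¹ * y)
    (by fun_prop) (by fun_prop), h, lintegral_smul_measure,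
    lintegral_add_left_eq_self (μ := volume) G]
  simp

theorem lintegral_incrementSq_midpoint_le {c d r x : ℝ} {f : ℝ → ℝ} (hf : Measurable f)
    (hx : x ∈ Ioo c d) :
    ∫⁻ y in Ioo c d, incrementSq f r x ((x + y) / 2) ≤
      2 * ∫⁻ y in Ioo c d, incrementSq f r x y := by
  rw [← lintegral_indicator measurableSet_Ioo, ← lintegral_indicator measurableSet_Ioo,
    ← lintegral_comp_midpoint x]
  · refine lintegral_mono fun y => ?_
    by_cases hy : y ∈ Ioo c d
    · have : (x + y) / 2 ∈ Ioo c d := ⟨by linarith [hx.1, hy.1], by linarith [hx.2, hy.2]⟩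
      simp [indicator_of_mem hy, indicator_of_mem this]
    · simp [indicator_of_notMem hy]
  · exact ((measurable_incrementSq hf r).comp (by fun_prop : Measurable fun y => (x, y))).indicator
      measurableSet_Ioo

theorem incrementSq_two_mul_le (f : ℝ → ℝ) (r x y : ℝ) :
    incrementSq f (2 * r) x y ≤
      2 * incrementSq f r x ((x + y) / 2) + 2 * incrementSq f r y ((y + x) / 2) := by
  unfold incrementSq
  split_ifs with h h1 h2 h2
  · rw [add_comm y x, ← ENNReal.ofReal_ofNat 2, ← ENNReal.ofReal_mul (by norm_num),
      ← ENNReal.ofReal_mul (by norm_num), ← ENNReal.ofReal_add (by positivity) (by positivity)]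
    refine ENNReal.ofReal_le_ofReal ?_
    nlinarith [sq_nonneg (f ((x + y) / 2) - f x + (f ((x + y) / 2) - f y))]
  all_goals try exact zero_le
  all_goals
    exfalso
    rw [abs_lt] at *
    grind

theorem lintegral_incrementSq_two_mul_le {f : ℝ → ℝ} (hf : Measurable f) (c d r : ℝ) :
    ∫⁻ x in Ioo c d, ∫⁻ y in Ioo c d, incrementSq f (2 * r) x y ≤
      8 * ∫⁻ x in Ioo c d, ∫⁻ y in Ioo c d, incrementSq f r x y := by
  have hm : Measurable fun p : ℝ × ℝ => incrementSq f r p.1 ((p.1 + p.2) / 2) :=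
    (measurable_incrementSq hf r).comp (by fun_prop : Measurable fun p : ℝ × ℝ =>
      (p.1, (p.1 + p.2) / 2))
  have hm' : Measurable fun p : ℝ × ℝ => incrementSq f r p.2 ((p.2 + p.1) / 2) :=
    hm.comp measurable_swap
  have key : ∫⁻ x in Ioo c d, ∫⁻ y in Ioo c d, incrementSq f r x ((x + y) / 2) ≤
      2 * ∫⁻ x in Ioo c d, ∫⁻ y in Ioo c d, incrementSq f r x y := by
    rw [← lintegral_const_mul _ (measurable_incrementSq hf r).lintegral_prod_right']
    exact setLIntegral_mono' measurableSet_Ioo fun x hx => lintegral_incrementSq_midpoint_le hf hx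
  calc
    _ ≤ ∫⁻ x in Ioo c d, ∫⁻ y in Ioo c d, (2 * incrementSq f r x ((x + y) / 2)
          + 2 * incrementSq f r y ((y + x) / 2)) :=
      lintegral_mono fun x => lintegral_mono fun y => incrementSq_two_mul_le f r x y
    _ = 2 * (∫⁻ x in Ioo c d, ∫⁻ y in Ioo c d, incrementSq f r x ((x + y) / 2)) +
          2 * ∫⁻ x in Ioo c d, ∫⁻ y in Ioo c d, incrementSq f r y ((y + x) / 2) := by
      rw [← lintegral_const_mul _ hm.lintegral_prod_right',
        ← lintegral_const_mul _ hm'.lintegral_prod_right',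
        ← lintegral_add_left (hm.lintegral_prod_right'.const_mul 2)]
      congr 1
      funext x
      have h1 : Measurable fun y => incrementSq f r x ((x + y) / 2) :=
        hm.comp (by fun_prop : Measurable fun y : ℝ => (x, y))
      have h2 : Measurable fun y => incrementSq f r y ((y + x) / 2) :=
        hm'.comp (by fun_prop : Measurable fun y : ℝ => (x, y))
      rw [← lintegral_const_mul _ h1, ← lintegral_const_mul _ h2,
        ← lintegral_add_left (h1.const_mul 2)]
    _ = 4 * ∫⁻ x in Ioo c d, ∫⁻ y in Ioo c d, incrementSq f r x ((x + y) / 2) := by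
      rw [lintegral_lintegral_swap (f := fun x y => incrementSq f r y ((y + x) / 2))
        hm'.aemeasurable, ← add_mul]
      norm_num
    _ ≤ 4 * (2 * ∫⁻ x in Ioo c d, ∫⁻ y in Ioo c d, incrementSq f r x y) := by gcongr
    _ = _ := by rw [← mul_assoc]; norm_num

theorem lintegral_incrementSq_two_pow_le {f : ℝ → ℝ} (hf : Measurable f) (c d : ℝ) (n : ℕ) :
    ∫⁻ x in Ioo c d, ∫⁻ y in Ioo c d, incrementSq f (2 ^ n) x y ≤
      8 ^ n * ∫⁻ x in Ioo c d, ∫⁻ y in Ioo c d, incrementSq f 1 x y := by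
  induction n with
  | zero => simp
  | succ n ih =>
    rw [pow_succ', pow_succ', mul_assoc]
    exact (lintegral_incrementSq_two_mul_le hf c d _).trans (by gcongr)

theorem incrementSq_one_le_screenedKernel (f : ℝ → ℝ) (x y : ℝ) :
    incrementSq f 1 x y ≤ screenedKernel f x y := by
  unfold incrementSq screenedKernel
  split_ifs with h
  · refine ENNReal.ofReal_le_ofReal ?_
    rcases eq_or_ne y x with rfl | hxy
    · simp
    · have h0 : 0 < (y - x) ^ 2 := by have := sub_ne_zero.2 hxy; positivity
      rw [le_div_iff₀ h0]
      have : (y - x) ^ 2 ≤ 1 := by rw [← sq_abs]; exact pow_le_one₀ (abs_nonneg _) h.le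
      nlinarith [sq_nonneg (f y - f x)]
  · exact le_rfl

theorem exists_lintegral_sq_sub_le_screenedEnergy (c d : ℝ) :
    ∃ C : NNReal, ∀ f : ℝ → ℝ, Measurable f →
      ∫⁻ x in Ioo c d, ∫⁻ y in Ioo c d, ENNReal.ofReal ((f y - f x) ^ 2) ≤
        C * screenedEnergy (Ioo c d) f := by
  obtain ⟨n, hn⟩ := pow_unbounded_of_one_lt (d - c) (one_lt_two : (1 : ℝ) < 2)
  refine ⟨8 ^ n, fun f hf => ?_⟩
  calc
    _ ≤ ∫⁻ x in Ioo c d, ∫⁻ y in Ioo c d, incrementSq f (2 ^ n) x y := by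
      refine setLIntegral_mono' measurableSet_Ioo fun x hx =>
        setLIntegral_mono' measurableSet_Ioo fun y hy => ?_
      have : |y - x| < 2 ^ n := by
        rw [abs_lt]; constructor <;> linarith [hx.1, hx.2, hy.1, hy.2]
      rw [incrementSq, if_pos this]
    _ ≤ 8 ^ n * ∫⁻ x in Ioo c d, ∫⁻ y in Ioo c d, incrementSq f 1 x y :=
      lintegral_incrementSq_two_pow_le hf c d n
    _ ≤ _ := by
      push_cast
      unfold screenedEnergy
      gcongr with x y
      exact incrementSq_one_le_screenedKernel f x y

theorem ofReal_sq_eq_enorm_sq (a : ℝ) : ENNReal.ofReal (a ^ 2) = ‖a‖ₑ ^ (2 : ℝ) := by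
  rw [← sq_abs, ENNReal.ofReal_pow (abs_nonneg a), ← Real.enorm_eq_ofReal_abs]
  norm_cast

theorem ofReal_sq_integral_le {J : Set ℝ} {h : ℝ → ℝ} (hh : Measurable h) :
    ENNReal.ofReal ((∫ y in J, h y) ^ 2) ≤
      volume J * ∫⁻ y in J, ENNReal.ofReal ((h y) ^ 2) := by
  have h1 := eLpNorm'_le_eLpNorm'_mul_rpow_measure_univ (μ := volume.restrict J) one_pos
    (one_le_two : (1 : ℝ) ≤ 2) hh.aestronglyMeasurable
  simp only [eLpNorm', ENNReal.rpow_one, div_one, Measure.restrict_apply_univ] at h1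
  have h2 := ENNReal.rpow_le_rpow ((enorm_integral_le_lintegral_enorm h).trans h1)
    (zero_le_two : (0 : ℝ) ≤ 2)
  rw [ofReal_sq_eq_enorm_sq]
  refine h2.trans (le_of_eq ?_)
  rw [ENNReal.mul_rpow_of_nonneg _ _ zero_le_two, ← ENNReal.rpow_mul, ← ENNReal.rpow_mul]
  norm_num
  rw [mul_comm]
  congr 1
  refine lintegral_congr fun y => ?_
  rw [← sq_abs, ENNReal.ofReal_pow (abs_nonneg _), ← Real.enorm_eq_ofReal_abs]

/-- Poincaré inequality for the screened seminorm on a bounded interval. -/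
theorem exists_lintegral_sq_sub_avgOn_le {c d : ℝ} (hcd : c < d) :
    ∃ C : NNReal, ∀ f : ℝ → ℝ, Measurable f → IntegrableOn f (Ioo c d) →
      ∫⁻ x in Ioo c d, ENNReal.ofReal ((f x - avgOn (Ioo c d) f) ^ 2) ≤
        C * screenedEnergy (Ioo c d) f := by
  obtain ⟨C, hC⟩ := exists_lintegral_sq_sub_le_screenedEnergy c d
  have hpos : 0 < d - c := sub_pos.2 hcd
  refine ⟨(d - c)⁻¹.toNNReal * C, fun f hf hfi => ?_⟩
  have hpt : ∀ x, ENNReal.ofReal ((f x - avgOn (Ioo c d) f) ^ 2) ≤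
      ENNReal.ofReal (d - c)⁻¹ * ∫⁻ y in Ioo c d, ENNReal.ofReal ((f y - f x) ^ 2) := by
    intro x
    have e : (f x - avgOn (Ioo c d) f) ^ 2 =
        (d - c)⁻¹ * ((d - c)⁻¹ * (∫ y in Ioo c d, (f y - f x)) ^ 2) := by
      rw [integral_sub hfi (integrable_const _), avgOn, Real.volume_Ioo,
        ENNReal.toReal_ofReal hpos.le]
      simp [hpos.le]
      field_simp
      ring
    rw [e, ENNReal.ofReal_mul (by positivity), ENNReal.ofReal_mul (by positivity)]
    refine mul_le_mul_right ?_ _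
    calc
      _ ≤ ENNReal.ofReal (d - c)⁻¹ * (ENNReal.ofReal (d - c) *
            ∫⁻ y in Ioo c d, ENNReal.ofReal ((f y - f x) ^ 2)) := by
        gcongr
        simpa using ofReal_sq_integral_le (J := Ioo c d) (hf.sub_const (f x))
      _ = _ := by
        rw [← mul_assoc, ← ENNReal.ofReal_mul (by positivity), inv_mul_cancel₀ hpos.ne']
        simp
  calc
    _ ≤ ∫⁻ x in Ioo c d, ENNReal.ofReal (d - c)⁻¹ *
          ∫⁻ y in Ioo c d, ENNReal.ofReal ((f y - f x) ^ 2) := lintegral_mono hpt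
    _ = ENNReal.ofReal (d - c)⁻¹ *
          ∫⁻ x in Ioo c d, ∫⁻ y in Ioo c d, ENNReal.ofReal ((f y - f x) ^ 2) :=
      lintegral_const_mul' _ _ ENNReal.ofReal_ne_top
    _ ≤ ENNReal.ofReal (d - c)⁻¹ * (C * screenedEnergy (Ioo c d) f) := by
      gcongr; exact hC f hf
    _ = _ := by
      push_cast
      rw [mul_assoc]; rfl

/-- `p` is a contraction of `ℝ` that folds `S` onto `E`, covering it at most `N` times. -/
structure IsFold (p : ℝ → ℝ) (S E : Set ℝ) (N : NNReal) : Prop where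
  abs_sub_le : ∀ x y, |p y - p x| ≤ |y - x|
  lintegral_le : ∀ h : ℝ → ℝ≥0∞, ∫⁻ x in S, h (p x) ≤ N * ∫⁻ x in E, h x

namespace IsFold

variable {p : ℝ → ℝ} {S E : Set ℝ} {N : NNReal}

theorem measurable (hp : IsFold p S E N) : Measurable p :=
  (LipschitzWith.of_dist_le_mul (K := 1) fun x y => by
    simpa [Real.dist_eq] using hp.abs_sub_le y x).continuous.measurable

theorem lintegral_lintegral_le (hp : IsFold p S E N) (k : ℝ → ℝ → ℝ≥0∞) :
    ∫⁻ x in S, ∫⁻ y in S, k (p x) (p y) ≤ N * (N * ∫⁻ x in E, ∫⁻ y in E, k x y) :=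
  calc
    _ ≤ ∫⁻ x in S, N * ∫⁻ y in E, k (p x) y :=
      lintegral_mono fun x => hp.lintegral_le (k (p x))
    _ ≤ N * ∫⁻ x in E, N * ∫⁻ y in E, k x y := hp.lintegral_le fun z => N * ∫⁻ y in E, k z y
    _ = _ := by rw [lintegral_const_mul' _ _ ENNReal.coe_ne_top]

theorem setLIntegral_le (hp : IsFold p S E N) {S' J : Set ℝ} (hS' : S' ⊆ S)
    (hmS' : MeasurableSet S') (hJ : MeasurableSet J) (hmap : ∀ x ∈ S', p x ∈ J)
    (h : ℝ → ℝ≥0∞) : ∫⁻ x in S', h (p x) ≤ N * ∫⁻ x in E ∩ J, h x :=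
  calc
    _ ≤ ∫⁻ x in S', J.indicator h (p x) := by
      refine setLIntegral_mono' hmS' fun x hx => ?_
      rw [indicator_of_mem (hmap x hx)]
    _ ≤ ∫⁻ x in S, J.indicator h (p x) := lintegral_mono_set hS'
    _ ≤ N * ∫⁻ x in E, J.indicator h x := hp.lintegral_le _
    _ = _ := by
      rw [lintegral_indicator hJ, Measure.restrict_restrict hJ, inter_comm]

theorem integrableOn_comp (hp : IsFold p S E N) (hS : MeasurableSet S) (hE : MeasurableSet E)
    {f : ℝ → ℝ} (hf : Measurable f) (hfi : LocIntOn E f) {s : Set ℝ} (hs : MeasurableSet s)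
    (hb : Bornology.IsBounded s) : IntegrableOn (fun x => f (p x)) (S ∩ s) := by
  refine ⟨(hf.comp hp.measurable).aestronglyMeasurable, ?_⟩
  obtain ⟨R, hR⟩ := hb.subset_closedBall 0
  have hmap : ∀ x ∈ S ∩ s, p x ∈ Metric.closedBall (p 0) R := fun x hx => by
    have h1 := hR hx.2
    rw [Metric.mem_closedBall, Real.dist_eq] at *
    exact (hp.abs_sub_le 0 x).trans h1
  refine (hp.setLIntegral_le inter_subset_left (hS.inter hs) measurableSet_closedBall hmap
    fun x => ‖f x‖ₑ).trans_lt ?_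
  exact ENNReal.mul_lt_top ENNReal.coe_lt_top
    (hfi _ inter_subset_left (hE.inter measurableSet_closedBall)
      (Metric.isBounded_closedBall.subset inter_subset_right)).2

end IsFold

/-- A cutoff that vanishes off `S` and whose unit-scale variations inside `S` occur in `T`. -/
structure IsCutoff (φ : ℝ → ℝ) (S T : Set ℝ) (K : NNReal) : Prop where
  nonneg : ∀ x, 0 ≤ φ x
  le_one : ∀ x, φ x ≤ 1
  lipschitz : LipschitzWith K φ
  eq_zero : ∀ x ∉ S, φ x = 0
  mem_of_ne : ∀ x y, |y - x| < 1 → φ x ≠ φ y → x ∈ S → x ∈ T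

namespace IsCutoff

variable {φ p f : ℝ → ℝ} {S T E : Set ℝ} {K N : NNReal}

theorem sq_sub_le (hφ : IsCutoff φ S T K) (x y : ℝ) :
    (φ y - φ x) ^ 2 ≤ (K : ℝ) ^ 2 * (y - x) ^ 2 := by
  have := hφ.lipschitz.dist_le_mul y x
  rw [Real.dist_eq, Real.dist_eq] at this
  rw [← sq_abs, ← sq_abs (y - x), ← mul_pow]
  gcongr

/-- The product rule for difference quotients of `φ * g`. -/
theorem sq_sub_mul_div_le (hφ : IsCutoff φ S T K) (g : ℝ → ℝ) {x y : ℝ} (hxy : x ≠ y)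
    (h1 : |y - x| < 1) :
    (φ y * g y - φ x * g x) ^ 2 / (y - x) ^ 2 ≤
      2 * S.indicator (fun x => S.indicator (fun y => (g y - g x) ^ 2 / (y - x) ^ 2) y) x +
        2 * K ^ 2 * T.indicator (fun x => g x ^ 2) x +
        2 * K ^ 2 * T.indicator (fun x => g x ^ 2) y := by
  have h0 : 0 < (y - x) ^ 2 := by have := sub_ne_zero.2 hxy.symm; positivity
  have hL := hφ.sq_sub_le x y
  have hTx : 0 ≤ 2 * (K : ℝ) ^ 2 * T.indicator (fun x => g x ^ 2) x :=
    mul_nonneg (by positivity) (indicator_nonneg (fun _ _ => sq_nonneg _) _)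
  have hTy : 0 ≤ 2 * (K : ℝ) ^ 2 * T.indicator (fun x => g x ^ 2) y :=
    mul_nonneg (by positivity) (indicator_nonneg (fun _ _ => sq_nonneg _) _)
  have hne : φ x ≠ φ y → (x ∈ S → x ∈ T) ∧ (y ∈ S → y ∈ T) := fun h =>
    ⟨hφ.mem_of_ne x y h1 h, hφ.mem_of_ne y x (by rwa [abs_sub_comm]) h.symm⟩
  by_cases hx : x ∈ S <;> by_cases hy : y ∈ S
  · rw [indicator_of_mem hx, indicator_of_mem hy]
    have hφy : φ y ^ 2 ≤ 1 := pow_le_one₀ (hφ.nonneg y) (hφ.le_one y)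
    have hsq : φ y ^ 2 * (g y - g x) ^ 2 ≤ (g y - g x) ^ 2 :=
      mul_le_of_le_one_left (sq_nonneg _) hφy
    suffices H : (φ y * g y - φ x * g x) ^ 2 / (y - x) ^ 2 ≤
        2 * ((g y - g x) ^ 2 / (y - x) ^ 2) +
          2 * (K : ℝ) ^ 2 * T.indicator (fun x => g x ^ 2) x by linarith
    by_cases he : φ x = φ y
    · have : (φ y * g y - φ x * g x) ^ 2 / (y - x) ^ 2 ≤ (g y - g x) ^ 2 / (y - x) ^ 2 := by
        rw [he, ← mul_sub, mul_pow]
        gcongr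
      have h2 : 0 ≤ (g y - g x) ^ 2 / (y - x) ^ 2 := by positivity
      linarith
    · rw [indicator_of_mem ((hne he).1 hx), div_le_iff₀ h0, add_mul, mul_assoc,
        div_mul_cancel₀ _ h0.ne']
      have h3 := mul_le_mul_of_nonneg_left hL (sq_nonneg (g x))
      nlinarith [sq_nonneg (φ y * (g y - g x) - g x * (φ y - φ x))]
  · rw [indicator_of_mem hx, indicator_of_notMem hy, hφ.eq_zero y hy]
    suffices H : (0 * g y - φ x * g x) ^ 2 / (y - x) ^ 2 ≤
        2 * (K : ℝ) ^ 2 * T.indicator (fun x => g x ^ 2) x by linarith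
    by_cases he : φ x = φ y
    · rw [he, hφ.eq_zero y hy]; simpa using hTx
    · rw [indicator_of_mem ((hne he).1 hx), div_le_iff₀ h0]
      have h3 := mul_le_mul_of_nonneg_left hL (sq_nonneg (g x))
      rw [hφ.eq_zero y hy] at h3
      nlinarith [sq_nonneg (g x * φ x)]
  · rw [indicator_of_notMem hx, hφ.eq_zero x hx]
    suffices H : (φ y * g y - 0 * g x) ^ 2 / (y - x) ^ 2 ≤
        2 * (K : ℝ) ^ 2 * T.indicator (fun x => g x ^ 2) y by linarith
    by_cases he : φ x = φ y
    · rw [← he, hφ.eq_zero x hx]; simpa using hTy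
    · rw [indicator_of_mem ((hne he).2 hy), div_le_iff₀ h0]
      have h3 := mul_le_mul_of_nonneg_left hL (sq_nonneg (g y))
      rw [hφ.eq_zero x hx] at h3
      nlinarith [sq_nonneg (g y * φ y)]
  · rw [indicator_of_notMem hx, hφ.eq_zero x hx, hφ.eq_zero y hy]
    simp only [zero_mul, sub_zero]
    norm_num
    linarith

theorem screenedKernel_mul_le (hφ : IsCutoff φ S T K) (g : ℝ → ℝ) (x y : ℝ) :
    screenedKernel (fun x => φ x * g x) x y ≤
      2 * S.indicator (fun x => S.indicator (fun y => screenedKernel g x y) y) x +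
        (2 * K ^ 2 *
          (if |y - x| < 1 then T.indicator (fun x => ENNReal.ofReal (g x ^ 2)) x else 0) +
        2 * K ^ 2 *
          (if |x - y| < 1 then T.indicator (fun x => ENNReal.ofReal (g x ^ 2)) y else 0)) := by
  by_cases h1 : |y - x| < 1
  swap
  · simp [screenedKernel, h1]
  rcases eq_or_ne x y with rfl | hxy
  · simp [screenedKernel]
  have hT : ∀ z, T.indicator (fun x => ENNReal.ofReal (g x ^ 2)) z =
      ENNReal.ofReal (T.indicator (fun x => g x ^ 2) z) := fun z => by
    by_cases hz : z ∈ T <;> simp [hz]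
  have hS : S.indicator (fun x => S.indicator (fun y => screenedKernel g x y) y) x =
      ENNReal.ofReal
        (S.indicator (fun x => S.indicator (fun y => (g y - g x) ^ 2 / (y - x) ^ 2) y) x) := by
    by_cases hx : x ∈ S <;> by_cases hy : y ∈ S <;> simp [hx, hy, screenedKernel, h1]
  have hK : (2 * (K : ℝ≥0∞) ^ 2) = ENNReal.ofReal (2 * (K : ℝ) ^ 2) := by
    rw [ENNReal.ofReal_mul zero_le_two, ENNReal.ofReal_pow K.coe_nonneg]
    simp
  have hn : ∀ z, 0 ≤ T.indicator (fun x => g x ^ 2) z :=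
    fun z => indicator_nonneg (fun _ _ => sq_nonneg _) _
  have hn' : 0 ≤ S.indicator
      (fun x => S.indicator (fun y => (g y - g x) ^ 2 / (y - x) ^ 2) y) x :=
    indicator_nonneg (fun _ _ => indicator_nonneg (fun _ _ => by positivity) _) _
  have hx := hn x
  have hy := hn y
  rw [abs_sub_comm x y, if_pos h1, if_pos h1, screenedKernel, if_pos h1, hT, hT, hS, hK,
    ← ENNReal.ofReal_ofNat 2, ← ENNReal.ofReal_mul zero_le_two,
    ← ENNReal.ofReal_mul (by positivity), ← ENNReal.ofReal_mul (by positivity),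
    ← ENNReal.ofReal_add (by positivity) (by positivity),
    ← ENNReal.ofReal_add (by positivity) (by positivity), ← add_assoc]
  exact ENNReal.ofReal_le_ofReal (hφ.sq_sub_mul_div_le g hxy h1)

theorem screenedEnergy_mul_le (hφ : IsCutoff φ S T K) (hS : MeasurableSet S)
    (hT : MeasurableSet T) {g : ℝ → ℝ} (hg : Measurable g) :
    screenedEnergy univ (fun x => φ x * g x) ≤
      2 * screenedEnergy S g + 8 * K ^ 2 * ∫⁻ x in T, ENNReal.ofReal (g x ^ 2) := by
  set G : ℝ → ℝ≥0∞ := T.indicator fun x => ENNReal.ofReal (g x ^ 2) with hGdef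
  have hG : Measurable G := Measurable.indicator (by fun_prop) hT
  set W : ℝ → ℝ → ℝ≥0∞ := fun x y => if |y - x| < 1 then G x else 0 with hWdef
  have hW : Measurable fun q : ℝ × ℝ => W q.1 q.2 :=
    Measurable.ite (measurableSet_abs_sub_lt 1) (by fun_prop) measurable_const
  have hW' : Measurable fun q : ℝ × ℝ => W q.2 q.1 := hW.comp measurable_swap
  have hWint : ∫⁻ x, ∫⁻ y, W x y = 2 * ∫⁻ x in T, ENNReal.ofReal (g x ^ 2) := by
    rw [← lintegral_indicator hT, ← lintegral_const_mul _ hG]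
    congr 1
    funext x
    have : ∀ y, W x y = (Ioo (x - 1) (x + 1)).indicator (fun _ => G x) y := fun y => by
      have : y ∈ Ioo (x - 1) (x + 1) ↔ |y - x| < 1 := by
        rw [abs_lt, mem_Ioo]
        constructor <;> rintro ⟨_, _⟩ <;> constructor <;> linarith
      by_cases h : |y - x| < 1 <;> simp [indicator, this, hWdef, h]
    simp_rw [this]
    rw [lintegral_indicator measurableSet_Ioo, setLIntegral_const, Real.volume_Ioo, mul_comm]
    congr 1
    norm_num [show x + 1 - (x - 1) = 2 by ring]
  have hSint : ∫⁻ x, ∫⁻ y, S.indicator (fun x => S.indicator (fun y => screenedKernel g x y) y) x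
      = screenedEnergy S g := by
    rw [screenedEnergy, ← lintegral_indicator hS]
    congr 1
    funext x
    by_cases hx : x ∈ S
    · simp only [indicator_of_mem hx]
      rw [lintegral_indicator hS]
    · simp [indicator_of_notMem hx]
  have hc : (2 * (K : ℝ≥0∞) ^ 2) ≠ ⊤ := by finiteness
  have hWx : ∀ x, Measurable fun y => W x y := fun x =>
    hW.comp (by fun_prop : Measurable fun y : ℝ => (x, y))
  have hWx' : ∀ x, Measurable fun y => W y x := fun x =>
    hW'.comp (by fun_prop : Measurable fun y : ℝ => (x, y))
  have hWW : Measurable fun x => 2 * (K : ℝ≥0∞) ^ 2 * (∫⁻ y, W x y) +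
      2 * K ^ 2 * ∫⁻ y, W y x :=
    (hW.lintegral_prod_right'.const_mul _).add (hW'.lintegral_prod_right'.const_mul _)
  rw [screenedEnergy, Measure.restrict_univ]
  calc
    _ ≤ ∫⁻ x, ∫⁻ y, (2 * S.indicator (fun x => S.indicator (fun y => screenedKernel g x y) y) x +
          (2 * K ^ 2 * W x y + 2 * K ^ 2 * W y x)) :=
      lintegral_mono fun x => lintegral_mono fun y => hφ.screenedKernel_mul_le g x y
    _ = 2 * screenedEnergy S g + (2 * K ^ 2 * (∫⁻ x, ∫⁻ y, W x y) +
          2 * K ^ 2 * ∫⁻ x, ∫⁻ y, W y x) := by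
      rw [← hSint, ← lintegral_const_mul' _ _ ENNReal.ofNat_ne_top, ← lintegral_const_mul' _ _ hc,
        ← lintegral_const_mul' _ _ hc,
        ← lintegral_add_left (hW.lintegral_prod_right'.const_mul _),
        ← lintegral_add_right _ hWW]
      congr 1
      funext x
      have hm : Measurable fun y => 2 * (K : ℝ≥0∞) ^ 2 * W x y + 2 * K ^ 2 * W y x :=
        ((hWx x).const_mul _).add ((hWx' x).const_mul _)
      rw [lintegral_add_right _ hm,
        lintegral_add_left ((hWx x).const_mul _), lintegral_const_mul' _ _ ENNReal.ofNat_ne_top,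
        lintegral_const_mul' _ _ hc, lintegral_const_mul' _ _ hc]
    _ = _ := by
      rw [lintegral_lintegral_swap (f := fun x y => W y x) hW'.aemeasurable, hWint]
      ring

theorem locIntOn_mul_comp (hφ : IsCutoff φ S T K) (hp : IsFold p S E N) (hS : MeasurableSet S)
    (hE : MeasurableSet E) (hf : Measurable f) (hfi : LocIntOn E f) (a : ℝ) :
    LocIntOn univ fun x => φ x * (f (p x) - a) := by
  intro s _ hs hb
  have h1 : IntegrableOn (fun x => f (p x) - a) (S ∩ s) :=
    (hp.integrableOn_comp hS hE hf hfi hs hb).sub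
      (integrableOn_const ((hb.subset inter_subset_right).measure_lt_top.ne))
  have h2 : IntegrableOn (fun x => φ x * (f (p x) - a)) (S ∩ s) := by
    refine Integrable.bdd_mul (c := 1) h1 hφ.lipschitz.continuous.aestronglyMeasurable
      (Eventually.of_forall fun x => ?_)
    rw [Real.norm_eq_abs, abs_of_nonneg (hφ.nonneg x)]
    exact hφ.le_one x
  refine h2.of_forall_sdiff_eq_zero hs fun x hx => ?_
  rw [hφ.eq_zero x fun h => hx.2 ⟨h, hx.1⟩, zero_mul]

end IsCutoff

theorem IsFold.screenedKernel_comp_le {p : ℝ → ℝ} {S E : Set ℝ} {N : NNReal}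
    (hp : IsFold p S E N) (f : ℝ → ℝ) (a x y : ℝ) :
    screenedKernel (fun x => f (p x) - a) x y ≤ screenedKernel f (p x) (p y) := by
  have h := hp.abs_sub_le x y
  unfold screenedKernel
  split_ifs with h1 h2
  · refine ENNReal.ofReal_le_ofReal ?_
    rw [sub_sub_sub_cancel_right]
    rcases eq_or_ne (p y) (p x) with he | hne
    · simp [he]
    · have : 0 < (p y - p x) ^ 2 := by have := sub_ne_zero.2 hne; positivity
      exact div_le_div_of_nonneg_left (sq_nonneg _) this (sq_le_sq.2 h)
  · exact absurd (h.trans_lt h1) h2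
  · exact zero_le
  · exact le_rfl

theorem IsFold.screenedEnergy_comp_le {p : ℝ → ℝ} {S E : Set ℝ} {N : NNReal}
    (hp : IsFold p S E N) (f : ℝ → ℝ) (a : ℝ) :
    screenedEnergy S (fun x => f (p x) - a) ≤ N * (N * screenedEnergy E f) :=
  (lintegral_mono fun x => lintegral_mono fun y => hp.screenedKernel_comp_le f a x y).trans
    (hp.lintegral_lintegral_le (screenedKernel f))

theorem screenedEnergy_mul_comp_le {φ p f : ℝ → ℝ} {S T E J : Set ℝ} {K N : NNReal}
    (hφ : IsCutoff φ S T K) (hp : IsFold p S E N) (hS : MeasurableSet S) (hT : MeasurableSet T)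
    (hJ : MeasurableSet J) (hTS : T ⊆ S) (hmap : ∀ x ∈ T, p x ∈ J) (hf : Measurable f) (a : ℝ) :
    screenedEnergy univ (fun x => φ x * (f (p x) - a)) ≤
      2 * (N * (N * screenedEnergy E f)) +
        8 * K ^ 2 * (N * ∫⁻ x in E ∩ J, ENNReal.ofReal ((f x - a) ^ 2)) := by
  refine (hφ.screenedEnergy_mul_le hS hT ((hf.comp hp.measurable).sub_const a)).trans ?_
  gcongr
  · exact hp.screenedEnergy_comp_le f a
  · exact hp.setLIntegral_le hTS hT hJ hmap fun x => ENNReal.ofReal ((f x - a) ^ 2)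

theorem screenedEnergy_add_le {u v : ℝ → ℝ} (hu : Measurable u) (I : Set ℝ) :
    screenedEnergy I (fun x => u x + v x) ≤
      2 * (screenedEnergy I u + screenedEnergy I v) := by
  have h : ∀ x y, screenedKernel (fun x => u x + v x) x y ≤
      2 * (screenedKernel u x y + screenedKernel v x y) := fun x y => by
    unfold screenedKernel
    split_ifs
    · rw [← ENNReal.ofReal_add (by positivity) (by positivity), ← ENNReal.ofReal_ofNat 2,
        ← ENNReal.ofReal_mul zero_le_two, ← add_div, ← mul_div_assoc]
      refine ENNReal.ofReal_le_ofReal ?_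
      gcongr
      nlinarith [sq_nonneg (u y - u x - (v y - v x))]
    · simp
  have hk := measurable_screenedKernel hu
  refine (lintegral_mono fun x => lintegral_mono fun y => h x y).trans (le_of_eq ?_)
  simp_rw [lintegral_const_mul' _ _ ENNReal.ofNat_ne_top]
  congr 1
  unfold screenedEnergy
  rw [← lintegral_add_left hk.lintegral_prod_right']
  congr 1
  funext x
  exact lintegral_add_left (hk.comp (by fun_prop : Measurable fun y : ℝ => (x, y))) _

theorem screenedEnergy_const_add (I : Set ℝ) (a : ℝ) (u : ℝ → ℝ) :
    screenedEnergy I (fun x => a + u x) = screenedEnergy I u := by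
  simp [screenedEnergy, screenedKernel]

theorem screenedEnergy_const (I : Set ℝ) (a : ℝ) : screenedEnergy I (fun _ => a) = 0 := by
  simp [screenedEnergy, screenedKernel]

/-- The continuous function that is `0` left of `c`, `1` right of `d` and affine in between. -/
noncomputable def ramp (c d x : ℝ) : ℝ := max 0 (min 1 ((x - c) / (d - c)))

theorem ramp_nonneg (c d x : ℝ) : 0 ≤ ramp c d x := le_max_left _ _

theorem ramp_le_one (c d x : ℝ) : ramp c d x ≤ 1 := max_le zero_le_one (min_le_left _ _)

theorem ramp_of_le {c d x : ℝ} (hcd : c < d) (hx : x ≤ c) : ramp c d x = 0 :=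
  max_eq_left ((min_le_right _ _).trans
    (div_nonpos_of_nonpos_of_nonneg (sub_nonpos.2 hx) (sub_pos.2 hcd).le))

theorem ramp_of_ge {c d x : ℝ} (hcd : c < d) (hx : d ≤ x) : ramp c d x = 1 := by
  have : 1 ≤ (x - c) / (d - c) := by rw [one_le_div (sub_pos.2 hcd)]; linarith
  rw [ramp, min_eq_left this, max_eq_right zero_le_one]

theorem lipschitzWith_ramp {c d : ℝ} (hcd : c < d) :
    LipschitzWith (d - c)⁻¹.toNNReal (ramp c d) := by
  refine LipschitzWith.const_max (LipschitzWith.const_min (LipschitzWith.of_dist_le_mul ?_) 1) 0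
  intro x y
  have h : 0 < d - c := sub_pos.2 hcd
  rw [Real.dist_eq, Real.dist_eq, Real.coe_toNNReal _ (inv_pos.2 h).le, ← sub_div,
    sub_sub_sub_cancel_right, abs_div, abs_of_pos h, div_eq_inv_mul]

theorem isCutoff_ramp {c d : ℝ} (hcd : c < d) {S : Set ℝ} (hS : Ioi c ⊆ S) :
    IsCutoff (ramp c d) S (S ∩ Ioo (c - 1) (d + 1)) (d - c)⁻¹.toNNReal where
  nonneg := ramp_nonneg c d
  le_one := ramp_le_one c d
  lipschitz := lipschitzWith_ramp hcd
  eq_zero x hx := ramp_of_le hcd (not_lt.1 fun h => hx (hS h))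
  mem_of_ne x y h hne hx := by
    rw [abs_lt] at h
    refine ⟨hx, ?_, ?_⟩ <;> by_contra! hc <;> apply hne
    · rw [ramp_of_le hcd (by linarith), ramp_of_le hcd (by linarith)]
    · rw [ramp_of_ge hcd (by linarith), ramp_of_ge hcd (by linarith)]

/-- The trapezoidal cutoff equal to `1` on `[c, d]` and supported within distance `δ` of it. -/
theorem isCutoff_trapezoid (c d : ℝ) {δ : ℝ} (hδ : 0 < δ) :
    IsCutoff (fun x => min (ramp (c - δ) c x) (1 - ramp d (d + δ) x)) (Ioo (c - δ) (d + δ))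
      (Ioo (c - δ) (d + δ)) δ⁻¹.toNNReal where
  nonneg x := le_min (ramp_nonneg _ _ _) (sub_nonneg.2 (ramp_le_one _ _ _))
  le_one x := (min_le_left _ _).trans (ramp_le_one _ _ _)
  lipschitz := by
    have h1 : LipschitzWith δ⁻¹.toNNReal (ramp (c - δ) c) := by
      simpa using lipschitzWith_ramp (show c - δ < c by linarith)
    have h2 : LipschitzWith δ⁻¹.toNNReal fun x => 1 - ramp d (d + δ) x := by
      simpa using (LipschitzWith.const (1 : ℝ)).sub
        (lipschitzWith_ramp (show d < d + δ by linarith))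
    simpa using h1.min h2
  eq_zero x hx := by
    rcases le_or_gt x (c - δ) with h | h
    · rw [ramp_of_le (by linarith) h]
      exact min_eq_left (sub_nonneg.2 (ramp_le_one _ _ _))
    · rw [ramp_of_ge (by linarith) (not_lt.1 fun h' => hx ⟨h, h'⟩), sub_self]
      exact min_eq_right (ramp_nonneg _ _ _)
  mem_of_ne _ _ _ _ h := h

theorem isFold_id : IsFold (fun x => x) univ univ 1 where
  abs_sub_le _ _ := le_rfl
  lintegral_le h := by simp

theorem setLIntegral_comp_const_sub_le (c : ℝ) {A B : Set ℝ} (hA : MeasurableSet A)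
    (hB : MeasurableSet B) (hAB : ∀ x ∈ A, c - x ∈ B) (h : ℝ → ℝ≥0∞) :
    ∫⁻ x in A, h (c - x) ≤ ∫⁻ x in B, h x := by
  rw [← lintegral_indicator hB, ← lintegral_sub_left_eq_self (B.indicator h) c,
    ← lintegral_indicator hA]
  refine lintegral_mono fun x => ?_
  by_cases hx : x ∈ A
  · rw [indicator_of_mem hx, indicator_of_mem (hAB x hx)]
  · simp [hx]

theorem isFold_reflect (c δ : ℝ) : IsFold (fun x => c + |x - c|) (Ioi (c - δ)) (Ioi c) 2 where
  abs_sub_le x y := by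
    have := abs_abs_sub_abs_le (y - c) (x - c)
    simpa using this
  lintegral_le h := by
    have hsub : Ioi (c - δ) ⊆ Ioc (c - δ) c ∪ Ioi c := fun x hx => by
      rcases le_or_gt x c with h | h
      · exact Or.inl ⟨hx, h⟩
      · exact Or.inr h
    have h1 : ∫⁻ x in Ioc (c - δ) c, h (c + |x - c|) ≤ ∫⁻ x in Ioi c, h x := by
      rw [setLIntegral_congr Ioi_ae_eq_Ici]
      rw [setLIntegral_congr_fun (g := fun x => h (2 * c - x)) measurableSet_Ioc fun x hx => by
        simp only [abs_of_nonpos (sub_nonpos.2 hx.2)]; congr 1; ring]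
      exact setLIntegral_comp_const_sub_le _ measurableSet_Ioc measurableSet_Ici
        (fun x hx => by simp only [mem_Ici]; linarith [hx.2]) h
    have h2 : ∫⁻ x in Ioi c, h (c + |x - c|) = ∫⁻ x in Ioi c, h x :=
      setLIntegral_congr_fun measurableSet_Ioi fun x hx => by
        simp only [abs_of_pos (sub_pos.2 (mem_Ioi.1 hx))]; congr 1; ring
    calc
      _ ≤ _ := lintegral_mono_set hsub
      _ ≤ _ := lintegral_union_le _ _ _
      _ ≤ (∫⁻ x in Ioi c, h x) + ∫⁻ x in Ioi c, h x := add_le_add h1 h2.le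
      _ = _ := by rw [← two_mul]; rfl

theorem isFold_reflect_reflect {c d δ : ℝ} (hδ : δ ≤ d - c) :
    IsFold (fun x => d - |d - c - (|x - c|)|) (Ioo (c - δ) (d + δ)) (Ioo c d) 3 where
  abs_sub_le x y := by
    have h1 := abs_abs_sub_abs_le (d - c - |x - c|) (d - c - |y - c|)
    have h2 := abs_abs_sub_abs_le (y - c) (x - c)
    simp only [sub_sub_sub_cancel_left, sub_sub_sub_cancel_right] at *
    exact h1.trans h2
  lintegral_le h := by
    have hsub : Ioo (c - δ) (d + δ) ⊆ Ioc (c - δ) c ∪ (Ioo c d ∪ Ico d (d + δ)) := fun x hx => by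
      rcases le_or_gt x c with h | h
      · exact Or.inl ⟨hx.1, h⟩
      · rcases lt_or_ge x d with h' | h'
        · exact Or.inr (Or.inl ⟨h, h'⟩)
        · exact Or.inr (Or.inr ⟨h', hx.2⟩)
    have h1 : ∫⁻ x in Ioc (c - δ) c, h (d - |d - c - (|x - c|)|) ≤ ∫⁻ x in Ioo c d, h x := by
      rw [setLIntegral_congr Ioo_ae_eq_Icc]
      rw [setLIntegral_congr_fun (g := fun x => h (2 * c - x)) measurableSet_Ioc fun x hx => by
        simp only [abs_of_nonpos (sub_nonpos.2 hx.2)]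
        rw [abs_of_nonneg (by linarith [hx.1])]
        congr 1; ring]
      exact setLIntegral_comp_const_sub_le _ measurableSet_Ioc measurableSet_Icc
        (fun x hx => ⟨by linarith [hx.2], by linarith [hx.1]⟩) h
    have h2 : ∫⁻ x in Ioo c d, h (d - |d - c - (|x - c|)|) = ∫⁻ x in Ioo c d, h x :=
      setLIntegral_congr_fun measurableSet_Ioo fun x hx => by
        simp only [abs_of_pos (sub_pos.2 hx.1)]
        rw [abs_of_nonneg (by linarith [hx.2])]
        congr 1; ring
    have h3 : ∫⁻ x in Ico d (d + δ), h (d - |d - c - (|x - c|)|) ≤ ∫⁻ x in Ioo c d, h x := by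
      rw [setLIntegral_congr Ioo_ae_eq_Icc]
      rw [setLIntegral_congr_fun (g := fun x => h (2 * d - x)) measurableSet_Ico fun x hx => by
        simp only
        rw [abs_of_nonneg (show 0 ≤ x - c by linarith [hx.1, hx.2]),
          abs_of_nonpos (by linarith [hx.1])]
        congr 1; ring]
      exact setLIntegral_comp_const_sub_le _ measurableSet_Ico measurableSet_Icc
        (fun x hx => ⟨by linarith [hx.2], by linarith [hx.1]⟩) h
    calc
      _ ≤ _ := lintegral_mono_set hsub
      _ ≤ _ := lintegral_union_le _ _ _
      _ ≤ _ := add_le_add_right (lintegral_union_le _ _ _) _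
      _ ≤ (∫⁻ x in Ioo c d, h x) + ((∫⁻ x in Ioo c d, h x) + ∫⁻ x in Ioo c d, h x) :=
        add_le_add h1 (add_le_add h2.le h3)
      _ = (3 : ℝ≥0∞) * ∫⁻ x in Ioo c d, h x := by ring
      _ = _ := rfl

theorem LocIntOn.add {I : Set ℝ} {f g : ℝ → ℝ} (hf : LocIntOn I f) (hg : LocIntOn I g) :
    LocIntOn I fun x => f x + g x :=
  fun s hs hm hb => (hf s hs hm hb).add (hg s hs hm hb)

theorem LocIntOn.mono {I J : Set ℝ} {f : ℝ → ℝ} (hf : LocIntOn I f) (h : J ⊆ I) :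
    LocIntOn J f :=
  fun s hs => hf s (hs.trans h)

theorem LocIntOn.congr_ae {I : Set ℝ} {f g : ℝ → ℝ} (hf : LocIntOn I f)
    (h : ∀ᵐ x ∂volume.restrict I, f x = g x) : LocIntOn I g :=
  fun s hs hm hb => (hf s hs hm hb).congr (ae_restrict_of_ae_restrict_of_subset hs h)

theorem locIntOn_const (I : Set ℝ) (a : ℝ) : LocIntOn I fun _ => a :=
  fun _ _ _ hb => integrableOn_const hb.measure_lt_top.ne

theorem avgOn_congr_ae {J : Set ℝ} {f g : ℝ → ℝ} (h : ∀ᵐ x ∂volume.restrict J, f x = g x) :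
    avgOn J f = avgOn J g := by
  rw [avgOn, avgOn, integral_congr_ae h]

theorem LocIntOn.aemeasurable_Ioi {c : ℝ} {f : ℝ → ℝ} (hf : LocIntOn (Ioi c) f) :
    AEMeasurable f (volume.restrict (Ioi c)) := by
  have h : Ioi c = ⋃ n : ℕ, Ioo c (c + n) := by
    ext x
    simp only [mem_Ioi, mem_iUnion, mem_Ioo]
    refine ⟨fun hx => ?_, fun ⟨_, hx, _⟩ => hx⟩
    obtain ⟨n, hn⟩ := exists_nat_gt (x - c)
    exact ⟨n, hx, by linarith⟩
  rw [h, aemeasurable_iUnion_iff]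
  exact fun n =>
    (hf _ Ioo_subset_Ioi_self measurableSet_Ioo (Metric.isBounded_Ioo _ _)).aemeasurable

/-- The extension result for a measurable representative, in terms of squared seminorms. -/
theorem exists_extension_screenedEnergy_le {x₀ x₁ x₂ : ℝ} (h01 : x₀ < x₁) (h12 : x₁ < x₂) :
    ∃ M : NNReal, ∀ f : ℝ → ℝ, Measurable f → LocIntOn (Ioo x₀ x₁) f → LocIntOn (Ioi x₂) f →
      ∃ g : ℝ → ℝ, LocIntOn univ g ∧ (∀ x ∈ Ioo x₀ x₁ ∪ Ioi x₂, g x = f x) ∧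
        screenedEnergy univ g ≤ M * (screenedEnergy (Ioo x₀ x₁) f + screenedEnergy (Ioi x₂) f +
          ENNReal.ofReal ((avgOn (Ioo x₀ x₁) f - avgOn (Ioo x₂ (x₂ + 2)) f) ^ 2)) := by
  obtain ⟨C₁, hC₁⟩ := exists_lintegral_sq_sub_avgOn_le h01
  obtain ⟨C₂, hC₂⟩ := exists_lintegral_sq_sub_avgOn_le (show x₂ < x₂ + 2 by linarith)
  obtain ⟨δ, hδ, hδ1, hδ2, hδ3⟩ : ∃ δ : ℝ, 0 < δ ∧ δ ≤ 1 ∧ δ ≤ x₁ - x₀ ∧ δ ≤ x₂ - x₁ :=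
    ⟨min 1 (min (x₁ - x₀) (x₂ - x₁)), by simp [h01, h12], min_le_left _ _,
      (min_le_right _ _).trans (min_le_left _ _), (min_le_right _ _).trans (min_le_right _ _)⟩
  have hφ₁ := isCutoff_trapezoid x₀ x₁ hδ
  have hφ₂ := isCutoff_ramp (show x₂ - δ < x₂ by linarith) Subset.rfl
  have hη := isCutoff_ramp h12 (subset_univ _)
  have hp₁ := isFold_reflect_reflect hδ2
  have hp₂ := isFold_reflect x₂ δ
  set K₁ : NNReal := δ⁻¹.toNNReal
  set K₂ : NNReal := (x₂ - (x₂ - δ))⁻¹.toNNReal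
  set K₃ : NNReal := (x₂ - x₁)⁻¹.toNNReal
  set V : NNReal := (x₂ + 1 - (x₁ - 1)).toNNReal
  refine ⟨4 * (18 + 24 * K₁ ^ 2 * C₁) + 4 * (8 + 16 * K₂ ^ 2 * C₂) + 2 * (8 * K₃ ^ 2 * V),
    fun f hf hf₁ hf₂ => ?_⟩
  set a := avgOn (Ioo x₀ x₁) f
  set b := avgOn (Ioo x₂ (x₂ + 2)) f
  set u₁ : ℝ → ℝ := fun x => min (ramp (x₀ - δ) x₀ x) (1 - ramp x₁ (x₁ + δ) x) *
    (f (x₁ - |x₁ - x₀ - (|x - x₀|)|) - a)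
  set u₂ : ℝ → ℝ := fun x => ramp (x₂ - δ) x₂ x * (f (x₂ + |x - x₂|) - b)
  set u₃ : ℝ → ℝ := fun x => ramp x₁ x₂ x * ((fun _ => b - a) x - 0)
  have hm₁ : Measurable u₁ := hφ₁.lipschitz.continuous.measurable.mul
    ((hf.comp hp₁.measurable).sub_const a)
  have hm₂ : Measurable u₂ := hφ₂.lipschitz.continuous.measurable.mul
    ((hf.comp hp₂.measurable).sub_const b)
  have hl₁ : LocIntOn univ u₁ :=
    hφ₁.locIntOn_mul_comp hp₁ measurableSet_Ioo measurableSet_Ioo hf hf₁ a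
  have hl₂ : LocIntOn univ u₂ :=
    hφ₂.locIntOn_mul_comp hp₂ measurableSet_Ioi measurableSet_Ioi hf hf₂ b
  have hl₃ : LocIntOn univ u₃ := hη.locIntOn_mul_comp isFold_id MeasurableSet.univ
    MeasurableSet.univ measurable_const (locIntOn_const _ _) 0
  have he₁ : screenedEnergy univ u₁ ≤
      (18 + 24 * K₁ ^ 2 * C₁) * screenedEnergy (Ioo x₀ x₁) f := by
    refine (screenedEnergy_mul_comp_le hφ₁ hp₁ measurableSet_Ioo measurableSet_Ioo
      MeasurableSet.univ Subset.rfl (fun _ _ => mem_univ _) hf a).trans ?_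
    rw [inter_univ]
    have hi : IntegrableOn f (Ioo x₀ x₁) :=
      hf₁ _ Subset.rfl measurableSet_Ioo (Metric.isBounded_Ioo _ _)
    calc
      _ ≤ 2 * (((3 : NNReal) : ℝ≥0∞) * ((3 : NNReal) * screenedEnergy (Ioo x₀ x₁) f)) +
          8 * K₁ ^ 2 * ((3 : NNReal) * (C₁ * screenedEnergy (Ioo x₀ x₁) f)) := by
        gcongr; exact hC₁ f hf hi
      _ = _ := by push_cast; ring
  have he₂ : screenedEnergy univ u₂ ≤
      (8 + 16 * K₂ ^ 2 * C₂) * screenedEnergy (Ioi x₂) f := by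
    refine (screenedEnergy_mul_comp_le hφ₂ hp₂ measurableSet_Ioi
      (measurableSet_Ioi.inter measurableSet_Ioo) (measurableSet_Iio (a := x₂ + 2))
      inter_subset_left (fun x hx => ?_) hf b).trans ?_
    · have h1 : x₂ - δ < x := hx.1
      have : |x - x₂| < 2 := abs_lt.2 ⟨by linarith, by linarith [hx.2.2]⟩
      simp only [mem_Iio]
      linarith
    rw [Ioi_inter_Iio]
    have hi : IntegrableOn f (Ioo x₂ (x₂ + 2)) :=
      hf₂ _ Ioo_subset_Ioi_self measurableSet_Ioo (Metric.isBounded_Ioo _ _)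
    calc
      _ ≤ 2 * (((2 : NNReal) : ℝ≥0∞) * ((2 : NNReal) * screenedEnergy (Ioi x₂) f)) +
          8 * K₂ ^ 2 * ((2 : NNReal) * (C₂ * screenedEnergy (Ioi x₂) f)) := by
        gcongr
        exact (hC₂ f hf hi).trans (by gcongr; exact screenedEnergy_mono Ioo_subset_Ioi_self f)
      _ = _ := by push_cast; ring
  have he₃ : screenedEnergy univ u₃ ≤
      (8 * K₃ ^ 2 * V) * ENNReal.ofReal ((a - b) ^ 2) := by
    refine (screenedEnergy_mul_comp_le hη isFold_id MeasurableSet.univ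
      (MeasurableSet.univ.inter measurableSet_Ioo) measurableSet_Ioo
      inter_subset_left (fun x hx => hx.2) measurable_const 0).trans (le_of_eq ?_)
    rw [screenedEnergy_const, univ_inter, setLIntegral_const, Real.volume_Ioo, sub_zero,
      ← neg_sub a b, neg_sq]
    simp only [mul_zero, zero_add, ENNReal.coe_one, one_mul]
    rw [mul_assoc (8 * (K₃ : ℝ≥0∞) ^ 2), mul_comm (V : ℝ≥0∞)]
    rfl
  refine ⟨fun x => a + (u₁ x + u₂ x + u₃ x), (locIntOn_const _ a).add ((hl₁.add hl₂).add hl₃),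
    ?_, ?_⟩
  · rintro x (hx | hx)
    · have e₁ : u₁ x = f x - a := by
        simp only [u₁]
        rw [ramp_of_ge (by linarith) hx.1.le, ramp_of_le (by linarith) hx.2.le,
          abs_of_pos (sub_pos.2 hx.1), abs_of_pos (by linarith [hx.2])]
        norm_num
      have e₂ : u₂ x = 0 := by
        simp only [u₂]
        rw [ramp_of_le (by linarith) (by linarith [hx.2]), zero_mul]
      have e₃ : u₃ x = 0 := by
        simp only [u₃]
        rw [ramp_of_le h12 hx.2.le, zero_mul]
      simp only [e₁, e₂, e₃]
      ring
    · rw [mem_Ioi] at hx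
      have e₁ : u₁ x = 0 := by
        simp only [u₁]
        rw [ramp_of_ge (by linarith) (by linarith), ramp_of_ge (by linarith) (by linarith)]
        norm_num
      have e₂ : u₂ x = f x - b := by
        simp only [u₂]
        rw [ramp_of_ge (by linarith) hx.le, abs_of_pos (sub_pos.2 hx)]
        norm_num
      have e₃ : u₃ x = b - a := by
        simp only [u₃]
        rw [ramp_of_ge h12 hx.le]
        ring
      simp only [e₁, e₂, e₃]
      ring
  · rw [screenedEnergy_const_add]
    set E₁ := screenedEnergy (Ioo x₀ x₁) f
    set E₂ := screenedEnergy (Ioi x₂) f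
    set D := ENNReal.ofReal ((a - b) ^ 2)
    calc
      _ ≤ 2 * (2 * (screenedEnergy univ u₁ + screenedEnergy univ u₂) + screenedEnergy univ u₃) :=
        (screenedEnergy_add_le (hm₁.add hm₂) _).trans
          (by gcongr; exact screenedEnergy_add_le hm₁ _)
      _ ≤ 2 * (2 * ((18 + 24 * K₁ ^ 2 * C₁) * E₁ + (8 + 16 * K₂ ^ 2 * C₂) * E₂) +
            8 * K₃ ^ 2 * V * D) := by gcongr
      _ = 4 * (18 + 24 * K₁ ^ 2 * C₁) * E₁ + 4 * (8 + 16 * K₂ ^ 2 * C₂) * E₂ +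
            2 * (8 * K₃ ^ 2 * V) * D := by ring
      _ ≤ (4 * (18 + 24 * K₁ ^ 2 * C₁) + 4 * (8 + 16 * K₂ ^ 2 * C₂) + 2 * (8 * K₃ ^ 2 * V)) * E₁ +
          (4 * (18 + 24 * K₁ ^ 2 * C₁) + 4 * (8 + 16 * K₂ ^ 2 * C₂) + 2 * (8 * K₃ ^ 2 * V)) * E₂ +
          (4 * (18 + 24 * K₁ ^ 2 * C₁) + 4 * (8 + 16 * K₂ ^ 2 * C₂) + 2 * (8 * K₃ ^ 2 * V)) *
            D := by
        gcongr
        · exact le_self_add.trans le_self_add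
        · exact le_add_self.trans le_self_add
        · exact le_add_self
      _ = _ := by push_cast; ring

/-- extension across a gap. With `E₁ = (x₀, x₁)`, `E₂ = (x₂, +∞)` and
`I₂ = (x₂, x₂ + 2)`, there is `C > 0` depending only on `x₀, x₁, x₂` such that every
locally integrable `f` on `E₁ ∪ E₂` with finite screened seminorms on `E₁` and `E₂`
admits a locally integrable extension `f̃ : ℝ → ℝ`, equal to `f` a.e. on `E₁ ∪ E₂`, with
`|f̃|_{Ḣ^{1/2}(ℝ)} ≤ C (|f|_{Ḣ^{1/2}(E₁)} + |f|_{Ḣ^{1/2}(E₂)} + |avg_{E₁} f − avg_{I₂} f|)`. -/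
theorem statement11 (x₀ x₁ x₂ : ℝ) (h01 : x₀ < x₁) (h12 : x₁ < x₂) :
    ∃ C : ℝ, 0 < C ∧ ∀ f : ℝ → ℝ,
      LocIntOn (Set.Ioo x₀ x₁ ∪ Set.Ioi x₂) f →
      screenedSeminorm (Set.Ioo x₀ x₁) 1 f < ⊤ →
      screenedSeminorm (Set.Ioi x₂) 1 f < ⊤ →
      ∃ ftilde : ℝ → ℝ, LocIntOn Set.univ ftilde ∧
        (∀ᵐ x ∂volume.restrict (Set.Ioo x₀ x₁ ∪ Set.Ioi x₂), ftilde x = f x) ∧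
        screenedSeminorm Set.univ 1 ftilde ≤
          ENNReal.ofReal C *
            (screenedSeminorm (Set.Ioo x₀ x₁) 1 f + screenedSeminorm (Set.Ioi x₂) 1 f +
              ENNReal.ofReal
                |avgOn (Set.Ioo x₀ x₁) f - avgOn (Set.Ioo x₂ (x₂ + 2)) f|) := by
  obtain ⟨M, hM⟩ := exists_extension_screenedEnergy_le h01 h12
  refine ⟨M + 1, by positivity, fun f hf _ _ => ?_⟩
  have hf₁ : LocIntOn (Ioo x₀ x₁) f := hf.mono subset_union_left
  have hf₂ : LocIntOn (Ioi x₂) f := hf.mono subset_union_right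
  have hae : AEMeasurable f (volume.restrict (Ioo x₀ x₁ ∪ Ioi x₂)) :=
    aemeasurable_union_iff.2 ⟨(hf₁ _ Subset.rfl measurableSet_Ioo
      (Metric.isBounded_Ioo _ _)).aemeasurable, hf₂.aemeasurable_Ioi⟩
  have heq : ∀ᵐ x ∂volume.restrict (Ioo x₀ x₁ ∪ Ioi x₂), f x = hae.mk f x := hae.ae_eq_mk
  have heq₁ := ae_restrict_of_ae_restrict_of_subset subset_union_left heq
  have heq₂ := ae_restrict_of_ae_restrict_of_subset subset_union_right heq
  obtain ⟨g, hg, hgf, hle⟩ := hM (hae.mk f) hae.measurable_mk (hf₁.congr_ae heq₁)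
    (hf₂.congr_ae heq₂)
  refine ⟨g, hg, ?_, ?_⟩
  · filter_upwards [heq, ae_restrict_mem (measurableSet_Ioo.union measurableSet_Ioi)] with x h1 h2
    rw [hgf x h2, h1]
  · rw [← screenedEnergy_congr_ae heq₁, ← screenedEnergy_congr_ae heq₂, ← avgOn_congr_ae heq₁,
      ← avgOn_congr_ae (ae_restrict_of_ae_restrict_of_subset Ioo_subset_Ioi_self heq₂)] at hle
    rw [screenedSeminorm_one_eq, screenedSeminorm_one_eq, screenedSeminorm_one_eq]
    have hsqrt : ∀ r : ℝ, ENNReal.ofReal (r ^ 2) ^ (1 / 2 : ℝ) = ENNReal.ofReal |r| := fun r => by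
      rw [ofReal_sq_eq_enorm_sq, ← ENNReal.rpow_mul, ← Real.enorm_eq_ofReal_abs]
      norm_num
    have hhalf : (0 : ℝ) ≤ 1 / 2 := by norm_num
    have hhalf' : (1 / 2 : ℝ) ≤ 1 := by norm_num
    have hMM : (M : ℝ≥0∞) ^ (1 / 2 : ℝ) ≤ ENNReal.ofReal (M + 1) := by
      rw [ENNReal.ofReal_add M.coe_nonneg zero_le_one, ENNReal.ofReal_coe_nnreal,
        ENNReal.ofReal_one]
      calc
        (M : ℝ≥0∞) ^ (1 / 2 : ℝ) ≤ (M + 1 : ℝ≥0∞) ^ (1 / 2 : ℝ) := by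
          gcongr; exact le_self_add
        _ ≤ (M + 1 : ℝ≥0∞) ^ (1 : ℝ) := ENNReal.rpow_le_rpow_of_exponent_le le_add_self hhalf'
        _ = _ := ENNReal.rpow_one _
    refine (ENNReal.rpow_le_rpow hle hhalf).trans ?_
    rw [ENNReal.mul_rpow_of_nonneg _ _ hhalf, ← hsqrt]
    gcongr
    refine (ENNReal.rpow_add_le_add_rpow _ _ hhalf hhalf').trans ?_
    gcongr
    exact ENNReal.rpow_add_le_add_rpow _ _ hhalf hhalf'
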